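/- arXiv:0712.3120 — 5 statements merged into one kernel-verified Lean document; each statement's English description precedes it below -/
import Mathlib

section
/- Let T be an invertible n×n complex matrix with Im T := (T - Tᴴ)/(2i) positive semidefinite, and define log T := -i ∫₀^∞ ((T + it·I)⁻¹ - (1 + it)⁻¹·I) dt. Then det T = exp(tr(log T)). -/
open Matrix MeasureTheory
open scoped ComplexOrder

attribute [local instance] Matrix.normedAddCommGroup Matrix.normedSpace

/-- The matrix logarithm `log T := -i ∫₀^∞ ((T + it·I)⁻¹ - (1+it)⁻¹·I) dt` of a
matrix with positive semidefinite imaginary part. -/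
noncomputable def matLog {n : ℕ} (T : Matrix (Fin n) (Fin n) ℂ) : Matrix (Fin n) (Fin n) ℂ :=
  (-Complex.I) •
    ∫ t in Set.Ioi (0 : ℝ),
      ((T + (Complex.I * (t : ℂ)) • (1 : Matrix (Fin n) (Fin n) ℂ))⁻¹
        - (1 + Complex.I * (t : ℂ))⁻¹ • (1 : Matrix (Fin n) (Fin n) ℂ))

/-- The extended norm of the entrywise sup norm is continuous for the product topology. -/
noncomputable abbrev Matrix.continuousENorm (n : ℕ) :
    ContinuousENorm (Matrix (Fin n) (Fin n) ℂ) :=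
  SeminormedAddGroup.toContinuousENorm

attribute [local instance] Matrix.continuousENorm

lemma one_add_I_mul_ne_zero (t : ℝ) : 1 + Complex.I * (t : ℂ) ≠ 0 := fun h => by
  simpa using congrArg Complex.re h

/-- If `T` is invertible with positive semidefinite imaginary part, then `T + it` is invertible
for every `t ≥ 0`. -/
lemma isUnit_det_add_I_smul_one {n : ℕ} {T : Matrix (Fin n) (Fin n) ℂ} (hTinv : IsUnit T)
    (hT : ((2 * Complex.I)⁻¹ • (T - Tᴴ)).PosSemidef) {t : ℝ} (ht : 0 ≤ t) :
    IsUnit (T + (Complex.I * (t : ℂ)) • (1 : Matrix (Fin n) (Fin n) ℂ)).det := by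
  rcases ht.eq_or_lt with rfl | ht
  · simpa using (isUnit_iff_isUnit_det T).1 hTinv
  rw [isUnit_iff_ne_zero]
  intro hdet
  obtain ⟨v, hv, hv0⟩ := exists_mulVec_eq_zero_iff.2 hdet
  have hTv : T *ᵥ v = -((Complex.I * (t : ℂ)) • v) := by
    rw [add_mulVec, smul_mulVec, one_mulVec] at hv0
    exact eq_neg_of_add_eq_zero_left hv0
  have hTv' : star v ᵥ* Tᴴ = (Complex.I * (t : ℂ)) • star v := by
    rw [← star_mulVec, hTv]
    ext i
    simp
  have hpos := hT.dotProduct_mulVec_nonneg v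
  have hquad : star v ⬝ᵥ (((2 * Complex.I)⁻¹ • (T - Tᴴ)) *ᵥ v) = -((t : ℂ) * (star v ⬝ᵥ v)) := by
    rw [smul_mulVec, sub_mulVec, dotProduct_smul, dotProduct_sub, hTv, dotProduct_mulVec _ Tᴴ,
      hTv', dotProduct_neg, dotProduct_smul, smul_dotProduct]
    simp only [smul_eq_mul]
    field_simp
    ring
  rw [hquad, neg_nonneg] at hpos
  exact (mul_pos (Complex.zero_lt_real.2 ht) (dotProduct_star_self_pos_iff.2 hv)).not_ge hpos

/-- Jacobi's formula along the line `z ↦ T + z • 1`, at a point where the matrix is invertible. -/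
lemma hasDerivAt_det_add_smul_one {ι : Type*} [Fintype ι] [DecidableEq ι] (T : Matrix ι ι ℂ)
    (w : ℂ) (hw : IsUnit (T + w • (1 : Matrix ι ι ℂ)).det) :
    HasDerivAt (fun z : ℂ => (T + z • (1 : Matrix ι ι ℂ)).det)
      ((T + w • (1 : Matrix ι ι ℂ)).det * ((T + w • (1 : Matrix ι ι ℂ))⁻¹).trace) w := by
  set A := T + w • (1 : Matrix ι ι ℂ) with hA
  have hfac (z : ℂ) : (T + z • (1 : Matrix ι ι ℂ)).det = A.det * (1 + (z - w) • A⁻¹).det := by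
    rw [← det_mul, mul_add, mul_one, mul_smul_comm, mul_nonsing_inv _ hw, hA, sub_smul]
    congr 1
    abel
  rw [funext hfac, funext fun z => congrArg (A.det * ·) (det_one_add_smul (z - w) A⁻¹)]
  set p := (1 + (Polynomial.X : Polynomial ℂ) • A⁻¹.map Polynomial.C).det.divX.divX
  have hsub : HasDerivAt (fun z : ℂ => z - w) 1 w := (hasDerivAt_id w).sub_const w
  have hpoly := (((hsub.const_mul A⁻¹.trace).const_add 1).add
    (((p.hasDerivAt _).comp w hsub).mul (hsub.pow 2))).const_mul A.det
  refine hpoly.congr_deriv ?_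
  simp

/-- The integrand of `matLog` is continuous on `[0, ∞)`. -/
lemma continuousOn_matLog_integrand {n : ℕ} {T : Matrix (Fin n) (Fin n) ℂ} (hTinv : IsUnit T)
    (hT : ((2 * Complex.I)⁻¹ • (T - Tᴴ)).PosSemidef) :
    ContinuousOn (fun t : ℝ => (T + (Complex.I * (t : ℂ)) • (1 : Matrix (Fin n) (Fin n) ℂ))⁻¹
      - (1 + Complex.I * (t : ℂ))⁻¹ • (1 : Matrix (Fin n) (Fin n) ℂ)) (Set.Ici 0) := by
  intro t ht
  refine ContinuousAt.continuousWithinAt (ContinuousAt.sub ?_ ?_)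
  · have hlin : ContinuousAt
        (fun t : ℝ => T + (Complex.I * (t : ℂ)) • (1 : Matrix (Fin n) (Fin n) ℂ)) t := by fun_prop
    refine ContinuousAt.comp (g := Inv.inv) ?_ hlin
    refine continuousAt_matrix_inv _ ?_
    rw [Ring.inverse_eq_inv']
    exact continuousAt_inv₀ (isUnit_det_add_I_smul_one hTinv hT ht).ne_zero
  · have hlin : ContinuousAt (fun t : ℝ => 1 + Complex.I * (t : ℂ)) t := by fun_prop
    exact (hlin.inv₀ (one_add_I_mul_ne_zero t)).smul continuousAt_const

/-- The integrand of `matLog` is integrable on `[0, ∞)`. -/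
lemma integrableOn_matLog_integrand {n : ℕ} {T : Matrix (Fin n) (Fin n) ℂ} (hTinv : IsUnit T)
    (hT : ((2 * Complex.I)⁻¹ • (T - Tᴴ)).PosSemidef) :
    IntegrableOn (fun t : ℝ => (T + (Complex.I * (t : ℂ)) • (1 : Matrix (Fin n) (Fin n) ℂ))⁻¹
      - (1 + Complex.I * (t : ℂ))⁻¹ • (1 : Matrix (Fin n) (Fin n) ℂ)) (Set.Ici 0) := by
  refine ((continuousOn_matLog_integrand hTinv hT).locallyIntegrableOn
    measurableSet_Ici).integrableOn_of_isBigO_atTop (g := fun t : ℝ => t ^ (-2 : ℝ)) ?_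
    (integrableAtFilter_rpow_atTop_iff.2 (by norm_num))
  have hinv : Filter.Tendsto (fun t : ℝ => ((t⁻¹ : ℝ) : ℂ)) Filter.atTop (nhds 0) := by
    exact (Complex.continuous_ofReal.tendsto' 0 0 rfl).comp tendsto_inv_atTop_zero
  have hscal : Filter.Tendsto (fun t : ℝ => (((t⁻¹ : ℝ) : ℂ) + Complex.I)⁻¹) Filter.atTop
      (nhds (0 + Complex.I)⁻¹) :=
    (hinv.add_const _).inv₀ (by simp)
  have hmat : Filter.Tendsto (fun t : ℝ => (((t⁻¹ : ℝ) : ℂ) • T + Complex.I • 1)⁻¹) Filter.atTop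
      (nhds ((0 : ℂ) • T + Complex.I • (1 : Matrix (Fin n) (Fin n) ℂ))⁻¹) := by
    refine Filter.Tendsto.comp (ContinuousAt.tendsto ?_)
      ((hinv.smul_const T).add_const (Complex.I • (1 : Matrix (Fin n) (Fin n) ℂ)))
    refine continuousAt_matrix_inv _ ?_
    rw [Ring.inverse_eq_inv']
    exact continuousAt_inv₀ (by simp)
  have hprod := (hscal.smul (hmat.mul_const (1 - T))).isBigO_one ℝ
  have hbig := (Asymptotics.isBigO_refl (fun t : ℝ => t ^ (-2 : ℝ)) Filter.atTop).smul hprod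
  simp only [smul_eq_mul, mul_one] at hbig
  refine hbig.congr' ?_ Filter.EventuallyEq.rfl
  filter_upwards [Filter.eventually_gt_atTop 0] with t ht
  have htc : (t : ℂ) ≠ 0 := by exact_mod_cast ht.ne'
  have hA := isUnit_det_add_I_smul_one hTinv hT ht.le
  have hz := one_add_I_mul_ne_zero t
  set A := T + (Complex.I * (t : ℂ)) • (1 : Matrix (Fin n) (Fin n) ℂ) with hAdef
  have hresolvent : (((t⁻¹ : ℝ) : ℂ) • T + Complex.I • 1)⁻¹ = (t : ℂ) • A⁻¹ := by
    refine inv_eq_right_inv ?_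
    have : ((t⁻¹ : ℝ) : ℂ) • T + Complex.I • 1 = (t : ℂ)⁻¹ • A := by
      rw [hAdef, smul_add, smul_smul]
      congr 2
      · simp
      · field_simp
    rw [this, smul_mul_smul_comm, mul_nonsing_inv _ hA, inv_mul_cancel₀ htc, one_smul]
  have hscalar : (((t⁻¹ : ℝ) : ℂ) + Complex.I)⁻¹ = t * (1 + Complex.I * t)⁻¹ := by
    rw [← inv_inv (t : ℂ), ← mul_inv]
    congr 1
    push_cast
    field_simp
  have hone_sub : 1 - T = (1 + Complex.I * (t : ℂ)) • (1 : Matrix (Fin n) (Fin n) ℂ) - A := by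
    rw [hAdef, add_smul, one_smul]
    abel
  have hrpow : (t ^ (-2 : ℝ) : ℝ) = (t ^ 2)⁻¹ := by
    rw [Real.rpow_neg ht.le]
    norm_num
  rw [hresolvent, hscalar, hone_sub, smul_mul_assoc, mul_sub, nonsing_inv_mul _ hA, mul_smul_comm, mul_one, hrpow,
    ← Complex.coe_smul, smul_smul, smul_smul]
  have hcancel : (((t ^ 2)⁻¹ : ℝ) : ℂ) * (t * (1 + Complex.I * t)⁻¹) * t = (1 + Complex.I * t)⁻¹ := by
    push_cast
    field_simp
  rw [hcancel, smul_sub, smul_smul, inv_mul_cancel₀ hz, one_smul]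

/-- The determinant of `(1 + it)⁻¹ (T + it)` tends to `1` as `t → ∞`. -/
lemma tendsto_det_add_I_smul_one_div {n : ℕ} (T : Matrix (Fin n) (Fin n) ℂ) :
    Filter.Tendsto (fun t : ℝ => (T + (Complex.I * (t : ℂ)) • (1 : Matrix (Fin n) (Fin n) ℂ)).det
      / (1 + Complex.I * (t : ℂ)) ^ n) Filter.atTop (nhds 1) := by
  have hinv : Filter.Tendsto (fun t : ℝ => ((t⁻¹ : ℝ) : ℂ)) Filter.atTop (nhds 0) := by
    exact (Complex.continuous_ofReal.tendsto' 0 0 rfl).comp tendsto_inv_atTop_zero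
  have hnum : Filter.Tendsto (fun t : ℝ =>
      (((t⁻¹ : ℝ) : ℂ) • T + Complex.I • (1 : Matrix (Fin n) (Fin n) ℂ)).det) Filter.atTop
      (nhds ((0 : ℂ) • T + Complex.I • (1 : Matrix (Fin n) (Fin n) ℂ)).det) :=
    ((continuous_id.matrix_det).tendsto _).comp
      ((hinv.smul_const T).add_const (Complex.I • (1 : Matrix (Fin n) (Fin n) ℂ)))
  have hlim := hnum.div ((hinv.add_const Complex.I).pow n) (by simp)
  have hone : ((0 : ℂ) • T + Complex.I • (1 : Matrix (Fin n) (Fin n) ℂ)).det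
      / (0 + Complex.I) ^ n = 1 := by simp
  rw [hone] at hlim
  refine hlim.congr' ?_
  filter_upwards [Filter.eventually_gt_atTop 0] with t ht
  have htc : (t : ℂ) ≠ 0 := by exact_mod_cast ht.ne'
  have hmat : T + (Complex.I * (t : ℂ)) • (1 : Matrix (Fin n) (Fin n) ℂ)
      = (t : ℂ) • (((t⁻¹ : ℝ) : ℂ) • T + Complex.I • (1 : Matrix (Fin n) (Fin n) ℂ)) := by
    rw [smul_add, smul_smul, smul_smul, mul_comm Complex.I]
    simp [htc]
  have hden : 1 + Complex.I * (t : ℂ) = t * (((t⁻¹ : ℝ) : ℂ) + Complex.I) := by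
    push_cast
    field_simp
  rw [Pi.div_apply, hmat, hden, det_smul, mul_pow, Fintype.card_fin,
    mul_div_mul_left _ _ (pow_ne_zero n htc)]

/-- For an invertible matrix `T` with positive semidefinite imaginary part,
`det T = exp (tr (log T))`. -/
theorem det_eq_exp_trace_matLog (n : ℕ) (T : Matrix (Fin n) (Fin n) ℂ)
    (hTinv : IsUnit T)
    (hT : ((2 * Complex.I)⁻¹ • (T - Tᴴ)).PosSemidef) :
    T.det = Complex.exp (matLog T).trace := by
  set f : ℝ → Matrix (Fin n) (Fin n) ℂ := fun t : ℝ =>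
    (T + (Complex.I * (t : ℂ)) • (1 : Matrix (Fin n) (Fin n) ℂ))⁻¹
      - (1 + Complex.I * (t : ℂ))⁻¹ • (1 : Matrix (Fin n) (Fin n) ℂ) with hf
  have hfint : IntegrableOn f (Set.Ici 0) := integrableOn_matLog_integrand hTinv hT
  have hfcont : ContinuousOn f (Set.Ici 0) := continuousOn_matLog_integrand hTinv hT
  let L : Matrix (Fin n) (Fin n) ℂ →L[ℂ] ℂ :=
    LinearMap.toContinuousLinearMap (traceLinearMap (Fin n) ℂ ℂ)
  set g : ℝ → ℂ := fun t => (f t).trace with hg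
  have hgint : IntegrableOn g (Set.Ici 0) := L.integrable_comp hfint
  have hgcont : ContinuousOn g (Set.Ici 0) := L.continuous.comp_continuousOn hfcont
  have htrace : (matLog T).trace = -Complex.I * ∫ t in Set.Ioi (0 : ℝ), g t := by
    have := L.integral_comp_comm (hfint.mono_set Set.Ioi_subset_Ici_self)
    change ∫ t in Set.Ioi (0 : ℝ), g t = (∫ t in Set.Ioi (0 : ℝ), f t).trace at this
    rw [this, matLog, trace_smul, smul_eq_mul]
  set D : ℝ → ℂ := fun t => (T + (Complex.I * (t : ℂ)) • (1 : Matrix (Fin n) (Fin n) ℂ)).det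
      / (1 + Complex.I * (t : ℂ)) ^ n with hD
  have hDderiv {t : ℝ} (ht : 0 ≤ t) : HasDerivAt D (D t * (Complex.I * g t)) t := by
    have hlin : HasDerivAt (fun t : ℝ => Complex.I * (t : ℂ)) Complex.I t := by
      simpa using (Complex.ofRealCLM.hasDerivAt (x := t)).const_mul Complex.I
    have hz := one_add_I_mul_ne_zero t
    have hdet := (hasDerivAt_det_add_smul_one T (Complex.I * (t : ℂ))
      (isUnit_det_add_I_smul_one hTinv hT ht)).comp t hlin
    refine (hdet.div ((hlin.const_add 1).pow n) (pow_ne_zero n hz)).congr_deriv ?_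
    simp only [hD, hg, hf, trace_sub, trace_smul, trace_one, Fintype.card_fin, smul_eq_mul,
      Function.comp_apply]
    rcases n with _ | n
    · simp
    · simp only [Nat.add_sub_cancel, Pi.pow_apply]
      field_simp
      ring
  have hDzero : D 0 = T.det := by simp [hD]
  set E : ℝ → ℂ := fun t => D t * Complex.exp (-Complex.I * ∫ s in (0 : ℝ)..t, g s) with hE
  have hgint' {t : ℝ} (ht : 0 ≤ t) : IntervalIntegrable g volume 0 t :=
    (hgcont.mono (by rw [Set.uIcc_of_le ht]; exact Set.Icc_subset_Ici_self)).intervalIntegrable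
  have hEderiv {t : ℝ} (ht : 0 ≤ t) : HasDerivWithinAt E 0 (Set.Ici t) t := by
    have hcont : ContinuousOn g (Set.Ioi t) :=
      hgcont.mono fun s hs => ht.trans (Set.mem_Ioi.1 hs).le
    have hprim : HasDerivWithinAt (fun u => ∫ s in (0 : ℝ)..u, g s) (g t) (Set.Ici t) t :=
      intervalIntegral.integral_hasDerivWithinAt_right (hgint' ht)
        ⟨Set.Ioi t, self_mem_nhdsWithin, hcont.aestronglyMeasurable measurableSet_Ioi⟩
        ((hgcont t ht).mono fun s hs => ht.trans (Set.mem_Ioi.1 hs).le)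
    refine ((hDderiv ht).hasDerivWithinAt.mul (hprim.const_mul (-Complex.I)).cexp).congr_deriv ?_
    ring
  have hEcont {b : ℝ} (hb : 0 ≤ b) : ContinuousOn E (Set.Icc 0 b) := by
    refine ContinuousOn.mul (fun t ht => (hDderiv ht.1).continuousAt.continuousWithinAt) ?_
    refine ContinuousOn.cexp (continuousOn_const.mul ?_)
    have := intervalIntegral.continuousOn_primitive_interval (μ := volume) (f := g) (a := 0)
      (b := b) (hgint.mono_set (by rw [Set.uIcc_of_le hb]; exact Set.Icc_subset_Ici_self))
    rwa [Set.uIcc_of_le hb] at this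
  have hEconst {b : ℝ} (hb : 0 ≤ b) : E b = T.det := by
    rw [constant_of_has_deriv_right_zero (hEcont hb) (fun t ht => hEderiv ht.1) b
      (Set.right_mem_Icc.2 hb)]
    simp [hE, hDzero]
  have hElim : Filter.Tendsto E Filter.atTop
      (nhds (1 * Complex.exp (-Complex.I * ∫ s in Set.Ioi (0 : ℝ), g s))) :=
    (tendsto_det_add_I_smul_one_div T).mul ((intervalIntegral_tendsto_integral_Ioi 0
      (hgint.mono_set Set.Ioi_subset_Ici_self) Filter.tendsto_id).const_mul _).cexp
  rw [htrace, ← one_mul (Complex.exp _)]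
  refine tendsto_nhds_unique (Filter.Tendsto.congr' ?_ tendsto_const_nhds) hElim
  filter_upwards [Filter.eventually_ge_atTop 0] with b hb using (hEconst hb).symm
end

section
/- Let T be an invertible n×n complex matrix with Im T := (T - Tᴴ)/(2i) positive semidefinite, and define log T := -i ∫₀^∞ ((T + it·I)⁻¹ - (1 + it)⁻¹·I) dt. Then 0 ≤ Im(tr(log T)) ≤ n·π. -/
open Matrix MeasureTheory
open scoped ComplexOrder

attribute [local instance] Matrix.normedAddCommGroup Matrix.normedSpace

open Polynomial in
/-- The trace of the resolvent is the sum of `1 / (x - r)` over the eigenvalues `r`. -/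
theorem trace_inv_scalar_sub {n : ℕ} (T : Matrix (Fin n) (Fin n) ℂ) (x : ℂ)
    (hx : T.charpoly.eval x ≠ 0) :
    ((Matrix.scalar (Fin n) x - T)⁻¹).trace = (T.charpoly.roots.map fun r ↦ 1 / (x - r)).sum := by
  rw [← (IsAlgClosed.splits T.charpoly).eval_derivative_div_eval_of_ne_zero hx,
    eq_div_iff hx, mul_comm]
  set M := Matrix.scalar (Fin n) x - T with hM
  have hdet : M.det = T.charpoly.eval x := (Matrix.eval_charpoly T x).symm
  have hMM : M * M⁻¹ = 1 := Matrix.mul_nonsing_inv M (by rw [hdet]; exact hx.isUnit)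
  have hcomp : T.charpoly.comp (C x + X) = C M.det * det (1 + (X : ℂ[X]) • M⁻¹.map C) := by
    refine Polynomial.funext fun h ↦ ?_
    have hfac : Matrix.scalar (Fin n) (x + h) - T = M * (1 + h • M⁻¹) := by
      rw [mul_add, mul_one, mul_smul_comm, hMM, hM, map_add, Matrix.smul_one_eq_diagonal]
      simp only [Matrix.scalar_apply]
      abel
    have hmap : (evalRingHom h).mapMatrix (1 + (X : ℂ[X]) • M⁻¹.map C) = 1 + h • M⁻¹ := by
      ext i j
      by_cases hij : i = j <;> simp [hij, mul_comm h]
    rw [eval_comp, eval_add, eval_C, eval_X, Matrix.eval_charpoly, hfac, Matrix.det_mul, eval_mul,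
      eval_C, ← hmap, ← RingHom.map_det, coe_evalRingHom]
  have hder := congrArg (fun p ↦ (derivative p).eval 0) hcomp
  simp only [derivative_comp, derivative_mul, derivative_C, zero_mul, zero_add, eval_mul, eval_C,
    derivative_det_one_add_X_smul, hdet, eval_comp, eval_add, eval_X, derivative_add, derivative_X,
    add_zero, one_mul] at hder
  exact hder.symm

/-- The eigenvalues of a matrix with positive semidefinite imaginary part lie in the closed upper
half-plane. -/
theorem im_nonneg_of_isRoot_charpoly {n : ℕ} {T : Matrix (Fin n) (Fin n) ℂ}
    (hT : ((2 * Complex.I)⁻¹ • (T - Tᴴ)).PosSemidef) {r : ℂ} (hr : T.charpoly.IsRoot r) :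
    0 ≤ r.im := by
  rw [Polynomial.IsRoot, Matrix.eval_charpoly, ← Matrix.exists_mulVec_eq_zero_iff] at hr
  obtain ⟨v, hv, hv0⟩ := hr
  have hTv : T *ᵥ v = r • v := by
    rw [Matrix.sub_mulVec, sub_eq_zero] at hv0
    rw [← hv0]
    ext i
    simp [Matrix.mulVec_diagonal]
  have hTv' : star v ⬝ᵥ (Tᴴ *ᵥ v) = star r * (star v ⬝ᵥ v) := by
    rw [Matrix.dotProduct_mulVec, ← Matrix.star_mulVec, hTv, star_smul, smul_dotProduct,
      smul_eq_mul]
  have hquad := hT.dotProduct_mulVec_nonneg v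
  rw [Matrix.smul_mulVec, Matrix.sub_mulVec, dotProduct_smul, dotProduct_sub, hTv', hTv,
    dotProduct_smul, smul_eq_mul, smul_eq_mul, ← sub_mul, ← mul_assoc] at hquad
  have him : (2 * Complex.I)⁻¹ * (r - star r) = (r.im : ℂ) := by
    rw [Complex.star_def, Complex.sub_conj]
    field_simp
    push_cast
    ring
  rw [him] at hquad
  have hpos : 0 < star v ⬝ᵥ v := dotProduct_star_self_pos_iff.mpr hv
  have := (Complex.le_def.mp hquad).1
  rw [Complex.re_ofReal_mul] at this
  exact nonneg_of_mul_nonneg_left this (Complex.lt_def.mp hpos).1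

/-- The Poisson-type kernel `a / (a² + (b + t)²)` is integrable on `(0, ∞)`, with integral bounded
by `π / 2` in absolute value when `b ≥ 0`. -/
theorem integrableOn_and_abs_integral_le (a b : ℝ) (hb : 0 ≤ b) :
    IntegrableOn (fun t : ℝ ↦ a / (a ^ 2 + (b + t) ^ 2)) (Set.Ioi 0) ∧
      |∫ t in Set.Ioi (0 : ℝ), a / (a ^ 2 + (b + t) ^ 2)| ≤ Real.pi / 2 := by
  have key : ∀ a : ℝ, 0 < a →
      IntegrableOn (fun t : ℝ ↦ a / (a ^ 2 + (b + t) ^ 2)) (Set.Ioi 0) ∧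
      |∫ t in Set.Ioi (0 : ℝ), a / (a ^ 2 + (b + t) ^ 2)| ≤ Real.pi / 2 := by
    intro a ha
    have hd : ∀ t ∈ Set.Ici (0 : ℝ),
        HasDerivAt (fun t ↦ Real.arctan ((b + t) / a)) (a / (a ^ 2 + (b + t) ^ 2)) t := by
      intro t _
      convert (((hasDerivAt_id' t).const_add b).div_const a).arctan using 1
      have : a ^ 2 + (b + t) ^ 2 ≠ 0 := by positivity
      field_simp
    have hp : ∀ t ∈ Set.Ioi (0 : ℝ), 0 ≤ a / (a ^ 2 + (b + t) ^ 2) := fun t _ ↦ by positivity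
    have hl : Filter.Tendsto (fun t ↦ Real.arctan ((b + t) / a)) Filter.atTop
        (nhds (Real.pi / 2)) :=
      (tendsto_nhds_of_tendsto_nhdsWithin Real.tendsto_arctan_atTop).comp
        ((Filter.tendsto_atTop_add_const_left _ b Filter.tendsto_id).atTop_div_const ha)
    refine ⟨integrableOn_Ioi_deriv_of_nonneg' hd hp hl, ?_⟩
    rw [integral_Ioi_of_hasDerivAt_of_nonneg' hd hp hl, add_zero, abs_le]
    have h0 : 0 ≤ Real.arctan (b / a) := Real.arctan_nonneg.mpr (by positivity)
    have h1 := Real.arctan_lt_pi_div_two (b / a)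
    constructor <;> linarith [Real.pi_pos]
  rcases lt_trichotomy a 0 with ha | rfl | ha
  · have := key (-a) (neg_pos.mpr ha)
    simp only [neg_sq, neg_div, integral_neg, abs_neg] at this
    exact ⟨by simpa using this.1.neg, this.2⟩
  · simpa using Real.pi_div_two_pos.le
  · exact key a ha

/-- The bound of `integrableOn_and_abs_integral_le`, summed over a multiset of points in the closed
upper half-plane. -/
theorem integrableOn_and_abs_integral_multiset_sum_le (s : Multiset ℂ) (hs : ∀ r ∈ s, 0 ≤ r.im) :
    IntegrableOn (fun t : ℝ ↦ (s.map fun r ↦ r.re / (r.re ^ 2 + (r.im + t) ^ 2)).sum)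
        (Set.Ioi 0) ∧
      |∫ t in Set.Ioi (0 : ℝ), (s.map fun r ↦ r.re / (r.re ^ 2 + (r.im + t) ^ 2)).sum|
        ≤ s.card * (Real.pi / 2) := by
  induction s using Multiset.induction_on with
  | empty => simp
  | cons r s ih =>
    obtain ⟨h1, h2⟩ := ih fun q hq ↦ hs q (Multiset.mem_cons_of_mem hq)
    obtain ⟨h3, h4⟩ :=
      integrableOn_and_abs_integral_le r.re r.im (hs r (Multiset.mem_cons_self r s))
    simp only [Multiset.map_cons, Multiset.sum_cons, Multiset.card_cons]
    refine ⟨h3.add h1, ?_⟩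
    rw [integral_add h3 h1]
    push_cast
    linarith [abs_add_le (∫ t in Set.Ioi (0 : ℝ), r.re / (r.re ^ 2 + (r.im + t) ^ 2))
      (∫ t in Set.Ioi (0 : ℝ), (s.map fun r ↦ r.re / (r.re ^ 2 + (r.im + t) ^ 2)).sum)]

theorem re_inv_add_I_mul (r : ℂ) (t : ℝ) :
    ((r + Complex.I * t)⁻¹).re = r.re / (r.re ^ 2 + (r.im + t) ^ 2) := by
  simp [Complex.inv_re, Complex.normSq_apply, pow_two]

/-- The real part of the trace of the resolvent at `-it`, in terms of the eigenvalues. -/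
theorem re_trace_inv_add {n : ℕ} {T : Matrix (Fin n) (Fin n) ℂ}
    (hT : ((2 * Complex.I)⁻¹ • (T - Tᴴ)).PosSemidef) {t : ℝ} (ht : 0 < t) :
    ((T + (Complex.I * (t : ℂ)) • (1 : Matrix (Fin n) (Fin n) ℂ))⁻¹).trace.re
      = (T.charpoly.roots.map fun r ↦ r.re / (r.re ^ 2 + (r.im + t) ^ 2)).sum := by
  have hx : T.charpoly.eval (-(Complex.I * t)) ≠ 0 := fun h ↦ by
    have := im_nonneg_of_isRoot_charpoly hT h
    simp at this
    linarith
  have hneg : T + (Complex.I * (t : ℂ)) • (1 : Matrix (Fin n) (Fin n) ℂ)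
      = -(Matrix.scalar (Fin n) (-(Complex.I * t)) - T) := by
    rw [map_neg, Matrix.smul_one_eq_diagonal, Matrix.scalar_apply]
    abel
  have hinv : (-(Matrix.scalar (Fin n) (-(Complex.I * t)) - T))⁻¹
      = -(Matrix.scalar (Fin n) (-(Complex.I * t)) - T)⁻¹ := by
    refine Matrix.inv_eq_right_inv ?_
    rw [neg_mul_neg]
    exact Matrix.mul_nonsing_inv _ (by rw [← Matrix.eval_charpoly]; exact hx.isUnit)
  rw [hneg, hinv, Matrix.trace_neg, trace_inv_scalar_sub T _ hx, ← Multiset.sum_map_neg',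
    ← Complex.reLm_coe, map_multiset_sum, Multiset.map_map, Multiset.map_map]
  refine congrArg Multiset.sum (Multiset.map_congr rfl fun r _ ↦ ?_)
  change (-(1 / (-(Complex.I * t) - r))).re = r.re / (r.re ^ 2 + (r.im + t) ^ 2)
  rw [← re_inv_add_I_mul, one_div, ← inv_neg]
  ring_nf

/-- A linear functional on a finite-dimensional space commutes with the Bochner integral of `f`,
unless that integral takes its default value `0`. -/
theorem integral_eq_zero_or_linearMap_integral_eq {α E : Type*} [MeasurableSpace α]
    {μ : Measure α} [NormedAddCommGroup E] [NormedSpace ℝ E] [FiniteDimensional ℝ E]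
    (L : E →ₗ[ℝ] ℝ) (f : α → E) :
    ∫ a, f a ∂μ = 0 ∨ L (∫ a, f a ∂μ) = ∫ a, L (f a) ∂μ := by
  by_cases hf : Integrable f μ
  · have := FiniteDimensional.complete ℝ E
    exact Or.inr (L.toContinuousLinearMap.integral_comp_comm hf).symm
  · exact Or.inl (integral_undef hf)

/-- For an invertible matrix `T` with positive semidefinite imaginary part,
`0 ≤ Im (tr (log T)) ≤ n·π`. -/
theorem im_trace_matLog_mem (n : ℕ) (T : Matrix (Fin n) (Fin n) ℂ)
    (hTinv : IsUnit T)
    (hT : ((2 * Complex.I)⁻¹ • (T - Tᴴ)).PosSemidef) :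
    0 ≤ (matLog T).trace.im ∧ (matLog T).trace.im ≤ n * Real.pi := by
  set F : ℝ → Matrix (Fin n) (Fin n) ℂ := fun t ↦
    (T + (Complex.I * (t : ℂ)) • (1 : Matrix (Fin n) (Fin n) ℂ))⁻¹
      - (1 + Complex.I * (t : ℂ))⁻¹ • (1 : Matrix (Fin n) (Fin n) ℂ) with hF
  have hlog : (matLog T).trace.im = -(∫ t in Set.Ioi (0 : ℝ), F t).trace.re := by
    rw [matLog, Matrix.trace_smul]
    simp [hF]
  rw [hlog]
  rcases integral_eq_zero_or_linearMap_integral_eq (μ := volume.restrict (Set.Ioi 0))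
    (Complex.reLm ∘ₗ Matrix.traceLinearMap (Fin n) ℝ ℂ) F with h0 | hL
  · rw [h0]
    simpa using by positivity
  replace hL : (∫ t in Set.Ioi (0 : ℝ), F t).trace.re =
    ∫ t in Set.Ioi (0 : ℝ), (F t).trace.re := hL
  have hroots : ∀ r ∈ T.charpoly.roots, 0 ≤ r.im := fun r hr ↦
    im_nonneg_of_isRoot_charpoly hT (Polynomial.isRoot_of_mem_roots hr)
  have hcard : T.charpoly.roots.card = n := by
    rw [← (IsAlgClosed.splits T.charpoly).natDegree_eq_card_roots,
      Matrix.charpoly_natDegree_eq_dim, Fintype.card_fin]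
  obtain ⟨h1, h2⟩ := integrableOn_and_abs_integral_multiset_sum_le _ hroots
  have hcongr : ∫ t in Set.Ioi (0 : ℝ), (F t).trace.re = ∫ t in Set.Ioi (0 : ℝ),
      ((T.charpoly.roots.map fun r ↦ r.re / (r.re ^ 2 + (r.im + t) ^ 2)).sum
        - (1 + t ^ 2)⁻¹ * (n : ℝ)) := by
    refine setIntegral_congr_fun measurableSet_Ioi fun t ht ↦ ?_
    have hone := re_inv_add_I_mul 1 t
    simp only [Complex.one_re, Complex.one_im, zero_add, one_pow, one_div] at hone
    simp only [hF, Matrix.trace_sub, Matrix.trace_smul, Matrix.trace_one, Fintype.card_fin,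
      Complex.sub_re, smul_eq_mul]
    rw [re_trace_inv_add hT ht, ← Complex.ofReal_natCast, Complex.re_mul_ofReal, hone]
  rw [hL, hcongr, integral_sub h1 (integrable_inv_one_add_sq.integrableOn.mul_const _),
    integral_mul_const, integral_Ioi_inv_one_add_sq, Real.arctan_zero, sub_zero]
  rw [hcard, abs_le] at h2
  constructor <;> linarith [h2.1, h2.2]
end

section
/- Let Ω ⊆ ℂ be open and let F : Ω → (n×n complex matrices) be holomorphic such that for every z ∈ Ω the matrix F(z) is invertible and Im F(z) := (F(z) - F(z)ᴴ)/(2i) is positive semidefinite. Then for every z₀ ∈ Ω the function z ↦ tr(log F(z)) is complex differentiable at z₀ with derivative tr(F(z₀)⁻¹ · F′(z₀)), where F′ denotes the complex derivative of F and log is the matrix logarithm log S := -i ∫₀^∞ ((S + it·I)⁻¹ - (1 + it)⁻¹·I) dt. -/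
open Matrix MeasureTheory
open scoped ComplexOrder

attribute [local instance] Matrix.normedAddCommGroup Matrix.normedSpace

/-- The resolvent of `a` at the point `-it` of the negative imaginary half-axis. -/
noncomputable def imagResolvent {A : Type*} [Ring A] [Algebra ℂ A] (a : A) (t : ℝ) : A :=
  Ring.inverse (a + (Complex.I * (t : ℂ)) • (1 : A))

section Banach

open Set Filter Topology

theorem inv_one_add_mul_self_le {t : ℝ} (ht : 0 ≤ t) :
    (1 + t)⁻¹ * (1 + t)⁻¹ ≤ (1 + t ^ 2)⁻¹ := by
  rw [← mul_inv]
  exact inv_anti₀ (by positivity) (by nlinarith)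

theorem norm_mul_mul_le_of_decay {A : Type*} [NormedRing A] {R S b : A} {C D t : ℝ}
    (ht : 0 ≤ t) (hC : 0 ≤ C) (hD : 0 ≤ D)
    (hR : ‖R‖ ≤ C * (1 + t)⁻¹) (hS : ‖S‖ ≤ D * (1 + t)⁻¹) :
    ‖R * b * S‖ ≤ C * ‖b‖ * D * (1 + t ^ 2)⁻¹ := by
  have h0 : 0 ≤ (1 + t)⁻¹ := by positivity
  calc ‖R * b * S‖ ≤ ‖R‖ * ‖b‖ * ‖S‖ :=
        (norm_mul_le _ _).trans (mul_le_mul_of_nonneg_right (norm_mul_le _ _) (norm_nonneg _))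
    _ ≤ (C * (1 + t)⁻¹) * ‖b‖ * (D * (1 + t)⁻¹) := by gcongr
    _ = C * ‖b‖ * D * ((1 + t)⁻¹ * (1 + t)⁻¹) := by ring
    _ ≤ _ := mul_le_mul_of_nonneg_left (inv_one_add_mul_self_le ht) (by positivity)

theorem HasDerivAt.ringInverse {𝕜 A : Type*} [NontriviallyNormedField 𝕜] [NormedRing A]
    [NormedAlgebra 𝕜 A] [CompleteSpace A] {f : 𝕜 → A} {f' : A} {x : 𝕜}
    (hf : HasDerivAt f f' x) (hu : IsUnit (f x)) :
    HasDerivAt (fun y => Ring.inverse (f y))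
      (-(Ring.inverse (f x) * f' * Ring.inverse (f x))) x := by
  obtain ⟨u, hu⟩ := hu
  have h := hasFDerivAt_ringInverse (𝕜 := 𝕜) u
  rw [hu] at h
  have h2 := h.comp_hasDerivAt x hf
  rw [← hu, Ring.inverse_unit]
  simpa [Function.comp_def] using h2

variable {A : Type*} [NormedRing A] [NormedAlgebra ℂ A]

theorem Ring.inverse_smul_of_isUnit {c : ℂ} (hc : c ≠ 0) {a : A} (ha : IsUnit a) :
    Ring.inverse (c • a) = c⁻¹ • Ring.inverse a := by
  have hu : IsUnit (c • a) := by
    simpa [Algebra.algebraMap_eq_smul_one] using ((IsUnit.mk0 c hc).map (algebraMap ℂ A)).mul ha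
  have h := (Ring.inverse_mul_eq_iff_eq_mul (c • a) 1 (c⁻¹ • Ring.inverse a) hu).2 (by
    rw [smul_mul_smul_comm, mul_inv_cancel₀ hc, Ring.mul_inverse_cancel a ha, one_smul])
  rwa [mul_one] at h

theorem isUnit_one_add_smul_one {t : ℝ} :
    IsUnit ((1 : A) + (Complex.I * (t : ℂ)) • (1 : A)) := by
  have h : (1 + Complex.I * (t : ℂ)) ≠ 0 := fun h => by
    have := congrArg Complex.re h
    simp at this
  have h' := (IsUnit.mk0 _ h).map (algebraMap ℂ A)
  rwa [Algebra.algebraMap_eq_smul_one, add_smul, one_smul] at h'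

theorem isUnit_smul_add_smul_one {a : A}
    (ha : ∀ t : ℝ, 0 ≤ t → IsUnit (a + (Complex.I * (t : ℂ)) • (1 : A)))
    {s : ℝ} (hs : s ∈ Icc (0 : ℝ) 1) :
    IsUnit ((s : ℂ) • a + (Complex.I * (1 - s : ℂ)) • (1 : A)) := by
  rcases hs.1.eq_or_lt with rfl | h0
  · have h' := (IsUnit.mk0 _ Complex.I_ne_zero).map (algebraMap ℂ A)
    rw [Algebra.algebraMap_eq_smul_one] at h'
    simpa using h'
  · have hsc : (s : ℂ) ≠ 0 := by exact_mod_cast h0.ne'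
    have hu := ha ((1 - s) / s) (div_nonneg (sub_nonneg.2 hs.2) h0.le)
    have h := ((IsUnit.mk0 _ hsc).map (algebraMap ℂ A)).mul hu
    rw [Algebra.algebraMap_eq_smul_one, smul_mul_assoc, one_mul, smul_add, smul_smul] at h
    convert h using 3
    push_cast
    field_simp

theorem imagResolvent_sub_one {a : A} {t : ℝ}
    (hu : IsUnit (a + (Complex.I * (t : ℂ)) • (1 : A))) :
    imagResolvent a t - imagResolvent 1 t = imagResolvent a t * (1 - a) * imagResolvent 1 t := by
  rw [imagResolvent, imagResolvent,
    Ring.inverse_sub_inverse (iff_of_true hu isUnit_one_add_smul_one)]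
  congr 2
  abel

variable [CompleteSpace A]

theorem exists_norm_imagResolvent_le {K : Set A} (hK : IsCompact K)
    (hu : ∀ a ∈ K, ∀ t : ℝ, 0 ≤ t → IsUnit (a + (Complex.I * (t : ℂ)) • (1 : A))) :
    ∃ C : ℝ, 0 ≤ C ∧ ∀ a ∈ K, ∀ t : ℝ, 0 ≤ t → ‖imagResolvent a t‖ ≤ C * (1 + t)⁻¹ := by
  have hc : ContinuousOn (fun p : ℝ × A =>
      Ring.inverse ((p.1 : ℂ) • p.2 + (Complex.I * (1 - p.1 : ℂ)) • (1 : A)))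
      (Icc (0 : ℝ) 1 ×ˢ K) := by
    rintro ⟨s, a⟩ ⟨hs, ha⟩
    obtain ⟨u, hu⟩ := isUnit_smul_add_smul_one (hu a ha) hs
    have h1 : ContinuousAt (Ring.inverse : A → A)
        ((s : ℂ) • a + (Complex.I * (1 - s : ℂ)) • (1 : A)) :=
      hu ▸ NormedRing.inverse_continuousAt u
    have h2 : ContinuousAt (fun p : ℝ × A =>
        (p.1 : ℂ) • p.2 + (Complex.I * (1 - p.1 : ℂ)) • (1 : A)) (s, a) := by
      fun_prop
    exact (ContinuousAt.comp (x := (s, a)) h1 h2).continuousWithinAt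
  obtain ⟨C, hC⟩ := (isCompact_Icc.prod hK).exists_bound_of_continuousOn hc
  refine ⟨max C 0, le_max_right _ _, fun a ha t ht => ?_⟩
  have ht1 : 0 < 1 + t := by linarith
  have htc : (1 + t : ℂ) ≠ 0 := by exact_mod_cast ht1.ne'
  have hs : (1 + t)⁻¹ ∈ Icc (0 : ℝ) 1 :=
    ⟨inv_nonneg.2 ht1.le, inv_le_one_of_one_le₀ (by linarith)⟩
  have hb := hC ((1 + t)⁻¹, a) ⟨hs, ha⟩
  have hz := isUnit_smul_add_smul_one (hu a ha) hs
  have he : imagResolvent a t = (((1 + t)⁻¹ : ℝ) : ℂ) • Ring.inverse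
      ((((1 + t)⁻¹ : ℝ) : ℂ) • a + (Complex.I * (1 - ((1 + t)⁻¹ : ℝ) : ℂ)) • (1 : A)) := by
    have h := Ring.inverse_smul_of_isUnit htc hz
    rw [smul_add, smul_smul, smul_smul] at h
    push_cast at h ⊢
    rw [mul_inv_cancel₀ htc, one_smul] at h
    rw [← h, imagResolvent]
    congr 3
    field_simp
    ring
  rw [he, norm_smul, Complex.norm_real, Real.norm_of_nonneg hs.1, mul_comm]
  exact mul_le_mul_of_nonneg_right (hb.trans (le_max_left _ _)) hs.1

theorem hasDerivAt_imagResolvent_right {a : A} {t : ℝ}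
    (hu : IsUnit (a + (Complex.I * (t : ℂ)) • (1 : A))) :
    HasDerivAt (imagResolvent a)
      (-(Complex.I • (imagResolvent a t * imagResolvent a t))) t := by
  have h : HasDerivAt (fun t : ℝ => a + (Complex.I * (t : ℂ)) • (1 : A))
      (Complex.I • (1 : A)) t := by
    have h1 : HasDerivAt (fun t : ℝ => Complex.I * (t : ℂ)) (Complex.I * 1) t :=
      (Complex.ofRealCLM.hasDerivAt (x := t)).const_mul Complex.I
    have := (h1.smul_const (1 : A)).const_add a
    rwa [mul_one] at this
  refine HasDerivAt.congr_deriv (h.ringInverse hu) ?_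
  simp [imagResolvent]

theorem continuousOn_imagResolvent {a : A}
    (hu : ∀ t : ℝ, 0 ≤ t → IsUnit (a + (Complex.I * (t : ℂ)) • (1 : A))) :
    ContinuousOn (imagResolvent a) (Ici 0) := fun t ht =>
  (hasDerivAt_imagResolvent_right (hu t ht)).continuousAt.continuousWithinAt

theorem integrableOn_imagResolvent_sub_one {a : A}
    (hu : ∀ t : ℝ, 0 ≤ t → IsUnit (a + (Complex.I * (t : ℂ)) • (1 : A))) :
    IntegrableOn (fun t => imagResolvent a t - imagResolvent 1 t) (Ioi 0) := by
  obtain ⟨C, hC0, hC⟩ := exists_norm_imagResolvent_le isCompact_singleton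
    (fun b (hb : b ∈ ({a} : Set A)) => (mem_singleton_iff.1 hb) ▸ hu)
  obtain ⟨D, hD0, hD⟩ := exists_norm_imagResolvent_le (isCompact_singleton (x := (1 : A)))
    (fun b hb t _ => by
      rw [mem_singleton_iff.1 hb]
      exact isUnit_one_add_smul_one)
  have hm : AEStronglyMeasurable (fun t => imagResolvent a t - imagResolvent 1 t)
      (volume.restrict (Ioi (0 : ℝ))) :=
    (((continuousOn_imagResolvent hu).sub
      (continuousOn_imagResolvent fun t _ => isUnit_one_add_smul_one)).mono
        Ioi_subset_Ici_self).aestronglyMeasurable measurableSet_Ioi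
  refine Integrable.mono' ((integrable_inv_one_add_sq.const_mul (C * ‖1 - a‖ * D)).integrableOn)
    hm ?_
  filter_upwards [ae_restrict_mem measurableSet_Ioi] with t ht
  rw [imagResolvent_sub_one (hu t (le_of_lt ht))]
  exact norm_mul_mul_le_of_decay (le_of_lt ht) hC0 hD0 (hC a rfl t (le_of_lt ht))
    (hD 1 rfl t (le_of_lt ht))

theorem integral_imagResolvent_mul_mul (τ : A →L[ℂ] ℂ) (hτ : ∀ x y, τ (x * y) = τ (y * x))
    {a b : A} (hu : ∀ t : ℝ, 0 ≤ t → IsUnit (a + (Complex.I * (t : ℂ)) • (1 : A)))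
    (hi : IntegrableOn (fun t => τ (-(imagResolvent a t * b * imagResolvent a t))) (Ioi 0)) :
    ∫ t in Ioi (0 : ℝ), τ (-(imagResolvent a t * b * imagResolvent a t)) =
      Complex.I * τ (Ring.inverse a * b) := by
  obtain ⟨C, hC0, hC⟩ := exists_norm_imagResolvent_le isCompact_singleton
    (fun c (hc : c ∈ ({a} : Set A)) => (mem_singleton_iff.1 hc) ▸ hu)
  have hd : ∀ t : ℝ, 0 ≤ t → HasDerivAt (fun t => -Complex.I * τ (imagResolvent a t * b))
      (τ (-(imagResolvent a t * b * imagResolvent a t))) t := by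
    intro t ht
    have h1 := (hasDerivAt_imagResolvent_right (hu t ht)).mul_const b
    have h2 := (((τ.restrictScalars ℝ).hasFDerivAt.comp_hasDerivAt t h1).const_mul (-Complex.I))
    refine HasDerivAt.congr_deriv h2 ?_
    have hc : τ (imagResolvent a t * b * imagResolvent a t) =
        τ (imagResolvent a t * imagResolvent a t * b) := by
      rw [hτ, mul_assoc]
    simp [hc, ← mul_assoc]
  have hlim : Tendsto (fun t => -Complex.I * τ (imagResolvent a t * b)) atTop (𝓝 0) := by
    have h0 : Tendsto (imagResolvent a) atTop (𝓝 0) := by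
      refine squeeze_zero_norm' (a := fun t => C * (1 + t)⁻¹) ?_ ?_
      · filter_upwards [eventually_ge_atTop 0] with t ht using hC a rfl t ht
      · simpa using (tendsto_inv_atTop_zero.comp
          (tendsto_atTop_add_const_left atTop (1 : ℝ) tendsto_id)).const_mul C
    have h1 := ((τ.continuous.tendsto _).comp (h0.mul_const b)).const_mul (-Complex.I)
    simpa using h1
  rw [integral_Ioi_of_hasDerivAt_of_tendsto (hd 0 le_rfl).continuousAt.continuousWithinAt
    (fun t ht => hd t (le_of_lt ht)) hi hlim]
  simp [imagResolvent]

theorem hasDerivAt_integral_imagResolvent (τ : A →L[ℂ] ℂ) (hτ : ∀ x y, τ (x * y) = τ (y * x))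
    {Ω : Set ℂ} (hΩ : IsOpen Ω) {f f' : ℂ → A} (hf : ∀ z ∈ Ω, HasDerivAt f (f' z) z)
    (hu : ∀ z ∈ Ω, ∀ t : ℝ, 0 ≤ t → IsUnit (f z + (Complex.I * (t : ℂ)) • (1 : A)))
    {z₀ : ℂ} (hz₀ : z₀ ∈ Ω) :
    HasDerivAt (fun z => ∫ t in Ioi (0 : ℝ), τ (imagResolvent (f z) t - imagResolvent 1 t))
      (Complex.I * τ (Ring.inverse (f z₀) * f' z₀)) z₀ := by
  obtain ⟨r, hr, hrΩ⟩ := Metric.nhds_basis_closedBall.mem_iff.1 (hΩ.mem_nhds hz₀)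
  have hdiff : DifferentiableOn ℂ f Ω := fun z hz =>
    (hf z hz).differentiableAt.differentiableWithinAt
  have hcK := isCompact_closedBall z₀ r
  obtain ⟨C, hC0, hC⟩ := exists_norm_imagResolvent_le
    (hcK.image_of_continuousOn (hdiff.continuousOn.mono hrΩ))
    (by rintro _ ⟨z, hz, rfl⟩; exact hu z (hrΩ hz))
  obtain ⟨M, hM⟩ := hcK.exists_bound_of_continuousOn
    ((hdiff.deriv hΩ).continuousOn.mono hrΩ)
  have hM' : ∀ z ∈ Metric.closedBall z₀ r, ‖f' z‖ ≤ M := fun z hz => by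
    simpa [(hf z (hrΩ hz)).deriv] using hM z hz
  have key := hasDerivAt_integral_of_dominated_loc_of_deriv_le
    (μ := volume.restrict (Ioi (0 : ℝ)))
    (F := fun z t => τ (imagResolvent (f z) t - imagResolvent 1 t))
    (F' := fun z t => τ (-(imagResolvent (f z) t * f' z * imagResolvent (f z) t)))
    (bound := fun t => ‖τ‖ * (C * M * C) * (1 + t ^ 2)⁻¹)
    (Metric.closedBall_mem_nhds z₀ hr)
    (by
      filter_upwards [hΩ.mem_nhds hz₀] with z hz
      exact (τ.integrable_comp (integrableOn_imagResolvent_sub_one (hu z hz))).1)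
    (τ.integrable_comp (integrableOn_imagResolvent_sub_one (hu z₀ hz₀)))
    (by
      have hc := (continuousOn_imagResolvent (hu z₀ hz₀)).mono Ioi_subset_Ici_self
      exact (τ.continuous.comp_continuousOn
        ((hc.mul continuousOn_const).mul hc).neg).aestronglyMeasurable measurableSet_Ioi)
    (by
      filter_upwards [ae_restrict_mem measurableSet_Ioi] with t ht z hz
      have hR := hC (f z) (mem_image_of_mem f hz) t (le_of_lt ht)
      have h := norm_mul_mul_le_of_decay (b := f' z) (le_of_lt ht) hC0 hC0 hR hR
      refine (τ.le_opNorm _).trans ?_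
      rw [norm_neg, mul_assoc ‖τ‖]
      have := hM' z hz
      refine mul_le_mul_of_nonneg_left (h.trans ?_) (norm_nonneg _)
      gcongr)
    (integrable_inv_one_add_sq.const_mul _).integrableOn
    (by
      filter_upwards [ae_restrict_mem measurableSet_Ioi] with t ht z hz
      have h1 := ((hf z (hrΩ hz)).add_const ((Complex.I * (t : ℂ)) • (1 : A))).ringInverse
        (hu z (hrΩ hz) t (le_of_lt ht))
      exact τ.hasFDerivAt.comp_hasDerivAt z (h1.sub_const (imagResolvent 1 t)))
  have h2 := key.2
  rwa [integral_imagResolvent_mul_mul τ hτ (hu z₀ hz₀) key.1] at h2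

end Banach

namespace Matrix

variable {n : ℕ}

theorem isUnit_add_smul_one_of_posSemidef_im {T : Matrix (Fin n) (Fin n) ℂ} (hT : IsUnit T)
    (hpos : ((2 * Complex.I)⁻¹ • (T - Tᴴ)).PosSemidef) {t : ℝ} (ht : 0 ≤ t) :
    IsUnit (T + (Complex.I * (t : ℂ)) • (1 : Matrix (Fin n) (Fin n) ℂ)) := by
  rcases ht.eq_or_lt with rfl | ht
  · simpa using hT
  set S := T + (Complex.I * (t : ℂ)) • (1 : Matrix (Fin n) (Fin n) ℂ) with hS
  have htc : (0 : ℂ) < t := by exact_mod_cast ht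
  have hpd : ((2 * Complex.I)⁻¹ • (S - Sᴴ)).PosDef := by
    have h : (2 * Complex.I)⁻¹ • (S - Sᴴ) =
        (2 * Complex.I)⁻¹ • (T - Tᴴ) + (t : ℂ) • (1 : Matrix (Fin n) (Fin n) ℂ) := by
      rw [hS, conjTranspose_add, conjTranspose_smul, conjTranspose_one, add_sub_add_comm,
        ← sub_smul, smul_add, smul_smul]
      congr 2
      simp
      field_simp
      linear_combination (-2) * Complex.I_sq
    rw [h]
    exact PosDef.posSemidef_add hpos (PosDef.one.smul htc)
  rw [← mulVec_injective_iff_isUnit]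
  refine (injective_iff_map_eq_zero (mulVecLin S)).2 fun v hv => ?_
  by_contra hv0
  rw [mulVecLin_apply] at hv
  have h1 := hpd.dotProduct_mulVec_pos hv0
  have h2 : star v ⬝ᵥ Sᴴ *ᵥ v = 0 := by
    rw [dotProduct_mulVec, ← star_mulVec, hv, star_zero, zero_dotProduct]
  rw [smul_mulVec, sub_mulVec, hv, dotProduct_smul, dotProduct_sub, h2, dotProduct_zero] at h1
  simp at h1

/-- The identification of square matrices with operators on Euclidean space, as a continuous
linear equivalence. -/
noncomputable def euclideanContinuousLinearEquiv (n : ℕ) : Matrix (Fin n) (Fin n) ℂ ≃L[ℂ]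
    (EuclideanSpace ℂ (Fin n) →L[ℂ] EuclideanSpace ℂ (Fin n)) :=
  (toEuclideanCLM (𝕜 := ℂ) (n := Fin n)).toAlgEquiv.toLinearEquiv.toContinuousLinearEquiv

theorem euclideanContinuousLinearEquiv_one : euclideanContinuousLinearEquiv n 1 = 1 :=
  map_one (toEuclideanCLM (𝕜 := ℂ) (n := Fin n))

theorem euclideanContinuousLinearEquiv_mul (S T : Matrix (Fin n) (Fin n) ℂ) :
    euclideanContinuousLinearEquiv n (S * T) =
      euclideanContinuousLinearEquiv n S * euclideanContinuousLinearEquiv n T :=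
  map_mul (toEuclideanCLM (𝕜 := ℂ) (n := Fin n)) S T

theorem isUnit_euclideanContinuousLinearEquiv {T : Matrix (Fin n) (Fin n) ℂ} (hT : IsUnit T) :
    IsUnit (euclideanContinuousLinearEquiv n T) :=
  hT.map (toEuclideanCLM (𝕜 := ℂ) (n := Fin n))

theorem euclideanContinuousLinearEquiv_inv {T : Matrix (Fin n) (Fin n) ℂ} (hT : IsUnit T) :
    euclideanContinuousLinearEquiv n T⁻¹ = Ring.inverse (euclideanContinuousLinearEquiv n T) := by
  have h := (Ring.inverse_mul_eq_iff_eq_mul (euclideanContinuousLinearEquiv n T) 1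
    (euclideanContinuousLinearEquiv n T⁻¹) (isUnit_euclideanContinuousLinearEquiv hT)).2 (by
      rw [← euclideanContinuousLinearEquiv_mul,
        mul_nonsing_inv T ((isUnit_iff_isUnit_det T).1 hT), euclideanContinuousLinearEquiv_one])
  rw [← h, mul_one]

/-- The trace of an operator on Euclidean space as a continuous linear functional. -/
noncomputable def euclideanTrace (n : ℕ) :
    (EuclideanSpace ℂ (Fin n) →L[ℂ] EuclideanSpace ℂ (Fin n)) →L[ℂ] ℂ :=
  (LinearMap.toContinuousLinearMap (traceLinearMap (Fin n) ℂ ℂ)).comp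
    (euclideanContinuousLinearEquiv n).symm.toContinuousLinearMap

theorem euclideanTrace_apply (T : Matrix (Fin n) (Fin n) ℂ) :
    euclideanTrace n (euclideanContinuousLinearEquiv n T) = T.trace := by
  simp [euclideanTrace]

theorem euclideanTrace_mul_comm (x y : EuclideanSpace ℂ (Fin n) →L[ℂ] EuclideanSpace ℂ (Fin n)) :
    euclideanTrace n (x * y) = euclideanTrace n (y * x) := by
  obtain ⟨S, rfl⟩ := (euclideanContinuousLinearEquiv n).surjective x
  obtain ⟨T, rfl⟩ := (euclideanContinuousLinearEquiv n).surjective y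
  rw [← euclideanContinuousLinearEquiv_mul, ← euclideanContinuousLinearEquiv_mul,
    euclideanTrace_apply, euclideanTrace_apply, trace_mul_comm]

theorem euclideanContinuousLinearEquiv_add_smul_one (T : Matrix (Fin n) (Fin n) ℂ) (c : ℂ) :
    euclideanContinuousLinearEquiv n (T + c • 1) = euclideanContinuousLinearEquiv n T + c • 1 := by
  rw [map_add, map_smul, euclideanContinuousLinearEquiv_one]

theorem trace_matLog_eq_integral {T : Matrix (Fin n) (Fin n) ℂ}
    (hu : ∀ t : ℝ, 0 ≤ t → IsUnit (T + (Complex.I * (t : ℂ)) • (1 : Matrix (Fin n) (Fin n) ℂ))) :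
    (matLog T).trace = -Complex.I * ∫ t in Set.Ioi (0 : ℝ), euclideanTrace n
      (imagResolvent (euclideanContinuousLinearEquiv n T) t - imagResolvent 1 t) := by
  have hu' : ∀ t : ℝ, 0 ≤ t →
      IsUnit (euclideanContinuousLinearEquiv n T + (Complex.I * (t : ℂ)) • 1) := fun t ht => by
    rw [← euclideanContinuousLinearEquiv_add_smul_one]
    exact isUnit_euclideanContinuousLinearEquiv (hu t ht)
  rw [(euclideanTrace n).integral_comp_comm (integrableOn_imagResolvent_sub_one hu'), matLog,
    trace_smul, smul_eq_mul, ← euclideanTrace_apply]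
  congr 2
  refine ((euclideanContinuousLinearEquiv n).integral_comp_comm _).symm.trans ?_
  refine setIntegral_congr_fun measurableSet_Ioi fun t ht => ?_
  have h1 : (1 + Complex.I * (t : ℂ))⁻¹ • 
      (1 : EuclideanSpace ℂ (Fin n) →L[ℂ] EuclideanSpace ℂ (Fin n)) =
      imagResolvent 1 t := by
    have hc : (1 + Complex.I * (t : ℂ)) ≠ 0 := fun h => by
      have := congrArg Complex.re h
      simp at this
    have h := Ring.inverse_smul_of_isUnit hc
      (isUnit_one (M := EuclideanSpace ℂ (Fin n) →L[ℂ] EuclideanSpace ℂ (Fin n)))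
    rw [Ring.inverse_one, add_smul, one_smul] at h
    exact h.symm
  change euclideanContinuousLinearEquiv n ((T + (Complex.I * (t : ℂ)) • 1)⁻¹ -
    (1 + Complex.I * (t : ℂ))⁻¹ • 1) =
      imagResolvent (euclideanContinuousLinearEquiv n T) t - imagResolvent 1 t
  rw [map_sub, map_smul, euclideanContinuousLinearEquiv_one, h1,
    euclideanContinuousLinearEquiv_inv (hu t (le_of_lt ht)),
    euclideanContinuousLinearEquiv_add_smul_one]
  rfl

end Matrix

/-- If `F` is holomorphic on an open set `Ω ⊆ ℂ` with values in the
invertible matrices with positive semidefinite imaginary part, then `z ↦ tr (log (F z))`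
is complex differentiable on `Ω` with derivative `tr (F(z₀)⁻¹ · F′(z₀))`. -/
theorem hasDerivAt_trace_matLog (n : ℕ) (Ω : Set ℂ) (hΩ : IsOpen Ω)
    (F F' : ℂ → Matrix (Fin n) (Fin n) ℂ)
    (hF : ∀ z ∈ Ω, HasDerivAt F (F' z) z)
    (hinv : ∀ z ∈ Ω, IsUnit (F z))
    (hpos : ∀ z ∈ Ω, ((2 * Complex.I)⁻¹ • (F z - (F z)ᴴ)).PosSemidef) :
    ∀ z₀ ∈ Ω, HasDerivAt (fun z => (matLog (F z)).trace)
      ((F z₀)⁻¹ * F' z₀).trace z₀ := by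
  intro z₀ hz₀
  have hu : ∀ z ∈ Ω, ∀ t : ℝ, 0 ≤ t →
      IsUnit (F z + (Complex.I * (t : ℂ)) • (1 : Matrix (Fin n) (Fin n) ℂ)) := fun z hz t ht =>
    isUnit_add_smul_one_of_posSemidef_im (hinv z hz) (hpos z hz) ht
  have h := (hasDerivAt_integral_imagResolvent (euclideanTrace n) euclideanTrace_mul_comm hΩ
    (f := fun z => euclideanContinuousLinearEquiv n (F z))
    (f' := fun z => euclideanContinuousLinearEquiv n (F' z))
    (fun z hz => (euclideanContinuousLinearEquiv n).hasFDerivAt.comp_hasDerivAt z (hF z hz))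
    (fun z hz t ht => by
      rw [← euclideanContinuousLinearEquiv_add_smul_one]
      exact isUnit_euclideanContinuousLinearEquiv (hu z hz t ht)) hz₀).const_mul (-Complex.I)
  rw [← euclideanContinuousLinearEquiv_inv (hinv z₀ hz₀), ← euclideanContinuousLinearEquiv_mul,
    euclideanTrace_apply, ← mul_assoc, neg_mul, Complex.I_mul_I, neg_neg, one_mul] at h
  refine h.congr_of_eventuallyEq ?_
  filter_upwards [hΩ.mem_nhds hz₀] with z hz
  exact trace_matLog_eq_integral (hu z hz)
end

section
/- Let T be an invertible n×n complex matrix and let C be an m×n complex matrix such that Cᴴ·C = -Im T, where Im T := (T - Tᴴ)/(2i). Then the m×m matrix S := I + 2i·C·T⁻¹·Cᴴ is unitary, i.e. Sᴴ·S = I. -/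
open Matrix
open scoped ComplexOrder

/-- If `T` is an invertible `n × n` matrix and `C` is an `m × n` matrix
with `Cᴴ C = -Im T`, then `S := I + 2i C T⁻¹ Cᴴ` is unitary: `Sᴴ S = I`. -/
theorem scatteringMatrix_unitary (n m : ℕ) (T : Matrix (Fin n) (Fin n) ℂ)
    (hT : IsUnit T) (C : Matrix (Fin m) (Fin n) ℂ)
    (hC : Cᴴ * C = -((2 * Complex.I)⁻¹ • (T - Tᴴ))) :
    ((1 : Matrix (Fin m) (Fin m) ℂ) + (2 * Complex.I) • (C * T⁻¹ * Cᴴ))ᴴ *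
        ((1 : Matrix (Fin m) (Fin m) ℂ) + (2 * Complex.I) • (C * T⁻¹ * Cᴴ)) = 1 := by
  have hdet : IsUnit T.det := (Matrix.isUnit_iff_isUnit_det T).mp hT
  have hdet' : IsUnit Tᴴ.det := by
    rw [Matrix.det_conjTranspose]
    exact hdet.star
  have key : (Tᴴ)⁻¹ * (Cᴴ * C) * T⁻¹ = -((2 * Complex.I)⁻¹ • ((Tᴴ)⁻¹ - T⁻¹)) := by
    rw [hC, mul_neg, neg_mul, Matrix.mul_smul, Matrix.smul_mul, mul_sub, sub_mul,
      Matrix.mul_nonsing_inv_cancel_right _ _ hdet, Matrix.nonsing_inv_mul _ hdet', one_mul]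
  have hprod : C * (Tᴴ)⁻¹ * Cᴴ * (C * T⁻¹ * Cᴴ)
      = -((2 * Complex.I)⁻¹ • (C * (Tᴴ)⁻¹ * Cᴴ - C * T⁻¹ * Cᴴ)) := by
    calc C * (Tᴴ)⁻¹ * Cᴴ * (C * T⁻¹ * Cᴴ)
        = C * ((Tᴴ)⁻¹ * (Cᴴ * C) * T⁻¹) * Cᴴ := by simp only [Matrix.mul_assoc]
      _ = _ := by
        rw [key, Matrix.mul_neg, Matrix.neg_mul, Matrix.mul_smul, Matrix.smul_mul,
          Matrix.mul_sub, Matrix.sub_mul]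
  have hadj : ((1 : Matrix (Fin m) (Fin m) ℂ) + (2 * Complex.I) • (C * T⁻¹ * Cᴴ))ᴴ
      = 1 + (-(2 * Complex.I)) • (C * (Tᴴ)⁻¹ * Cᴴ) := by
    simp [Matrix.conjTranspose_nonsing_inv, Matrix.mul_assoc]
  have h2I : (2 * Complex.I) ≠ 0 := by simp
  rw [hadj, add_mul, mul_add, mul_add, one_mul, one_mul, mul_one, Matrix.smul_mul,
    Matrix.mul_smul, hprod, smul_neg, smul_inv_smul₀ h2I]
  module
end

section
/- Let T be an invertible n×n complex matrix and let C be an m×n complex matrix such that -Im T - Cᴴ·C is positive semidefinite, where Im T := (T - Tᴴ)/(2i). Then the m×m matrix S := I + 2i·C·T⁻¹·Cᴴ is a contraction: the matrix I - S·Sᴴ is positive semidefinite. -/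
open Matrix
open scoped ComplexOrder

/-- If `T` is an invertible `n × n` matrix and `C` is an `m × n` matrix
such that `-Im T - Cᴴ C` is positive semidefinite, then `S := I + 2i C T⁻¹ Cᴴ` is a
contraction: `I - S Sᴴ` is positive semidefinite. -/
theorem scatteringMatrix_contraction (n m : ℕ) (T : Matrix (Fin n) (Fin n) ℂ)
    (hT : IsUnit T) (C : Matrix (Fin m) (Fin n) ℂ)
    (hC : (-((2 * Complex.I)⁻¹ • (T - Tᴴ)) - Cᴴ * C).PosSemidef) :
    ((1 : Matrix (Fin m) (Fin m) ℂ) -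
        ((1 : Matrix (Fin m) (Fin m) ℂ) + (2 * Complex.I) • (C * T⁻¹ * Cᴴ)) *
          ((1 : Matrix (Fin m) (Fin m) ℂ) + (2 * Complex.I) • (C * T⁻¹ * Cᴴ))ᴴ).PosSemidef := by
  have hdet : IsUnit T.det := (isUnit_iff_isUnit_det T).1 hT
  have hdet' : IsUnit Tᴴ.det := (isUnit_iff_isUnit_det Tᴴ).1 hT.star
  have hW : T⁻¹ - T⁻¹ᴴ = T⁻¹ * (Tᴴ - T) * T⁻¹ᴴ := by
    rw [Matrix.mul_sub, Matrix.sub_mul, nonsing_inv_mul _ hdet, Matrix.one_mul, Matrix.mul_assoc,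
      conjTranspose_nonsing_inv, mul_nonsing_inv _ hdet', Matrix.mul_one]
  have hI : (2 * Complex.I)⁻¹ * 4 = -(2 * Complex.I) := by
    rw [mul_inv, Complex.inv_I]
    ring
  have hI' : (2 * Complex.I) * (2 * Complex.I) = -4 := by
    linear_combination 4 * Complex.I_mul_I
  have hconj : star (2 * Complex.I) = -(2 * Complex.I) := by simp
  have h := (hC.mul_mul_conjTranspose_same (C * T⁻¹)).smul (show (0 : ℂ) ≤ 4 by norm_num)
  convert h using 1
  have hCW : C * T⁻¹ * (T - Tᴴ) * (C * T⁻¹)ᴴ = C * T⁻¹ᴴ * Cᴴ - C * T⁻¹ * Cᴴ := by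
    calc C * T⁻¹ * (T - Tᴴ) * (C * T⁻¹)ᴴ = -(C * (T⁻¹ * (Tᴴ - T) * T⁻¹ᴴ) * Cᴴ) := by
          rw [← neg_sub Tᴴ T]
          simp only [conjTranspose_mul, Matrix.mul_neg, Matrix.neg_mul, Matrix.mul_assoc]
      _ = C * T⁻¹ᴴ * Cᴴ - C * T⁻¹ * Cᴴ := by
          rw [← hW, Matrix.mul_sub, Matrix.sub_mul, neg_sub]
  have hCC : C * T⁻¹ * (Cᴴ * C) * (C * T⁻¹)ᴴ = C * T⁻¹ * Cᴴ * (C * T⁻¹ᴴ * Cᴴ) := by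
    simp only [conjTranspose_mul, Matrix.mul_assoc]
  have hS : (C * T⁻¹ * Cᴴ)ᴴ = C * T⁻¹ᴴ * Cᴴ := by
    simp only [conjTranspose_mul, conjTranspose_conjTranspose, Matrix.mul_assoc]
  rw [Matrix.mul_sub, Matrix.sub_mul, hCC, Matrix.mul_neg, Matrix.neg_mul, Matrix.mul_smul,
    Matrix.smul_mul, hCW, conjTranspose_add, conjTranspose_one, conjTranspose_smul, hS, hconj,
    smul_sub (4 : ℂ), smul_neg, smul_smul, mul_comm (4 : ℂ), hI, Matrix.add_mul, Matrix.mul_add,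
    Matrix.mul_add, Matrix.smul_mul, Matrix.mul_smul, Matrix.smul_mul, Matrix.mul_smul, smul_smul,
    mul_neg, hI']
  simp only [Matrix.one_mul, Matrix.mul_one]
  module
end
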